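/- Let A be a unital commutative ℝ-algebra generated by a linear subspace V ⊆ A, let q be a Hilbertian seminorm on V such that T_q := {α ∈ X(A) : α|_V is q-continuous} is nonempty, and let L be a normalized linear functional on A. Then: there exists a representing Radon measure ν for L with support contained in T_q if and only if there exist a Hilbertian seminorm p on V with tr(p/q) < ∞ and, for each S ∈ J, a representing Radon measure ν_S for L|_S on X(S), such that the family {ν_S : S ∈ J} is p-concentrated. -/

import Mathlib

open MeasureTheory
open scoped ENNReal

noncomputable section

/-- The character space `X(A)` of a unital commutative `ℝ`-algebra `A`:
the set of `ℝ`-algebra homomorphisms `A → ℝ`. -/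
abbrev Character (A : Type*) [CommRing A] [Algebra ℝ A] := A →ₐ[ℝ] ℝ

/-- The weak topology on the character space: the weakest topology making all
evaluations `α ↦ α a` continuous. -/
instance Character.instTopologicalSpace (A : Type*) [CommRing A] [Algebra ℝ A] :
    TopologicalSpace (Character A) :=
  TopologicalSpace.induced (fun (α : Character A) (a : A) => α a) inferInstance

/-- The Borel σ-algebra on the character space. -/
instance Character.instMeasurableSpace (A : Type*) [CommRing A] [Algebra ℝ A] :
    MeasurableSpace (Character A) :=
  borel (Character A)

/-- A Radon measure: a locally finite Borel measure that is inner regular with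
respect to compact sets. -/
def IsRadonMeasure {X : Type*} [TopologicalSpace X] [MeasurableSpace X]
    (μ : Measure X) : Prop :=
  IsLocallyFiniteMeasure μ ∧ μ.InnerRegularWRT IsCompact MeasurableSet

/-- A Hilbertian seminorm on a real vector space `V`: a seminorm induced by a
symmetric positive semidefinite bilinear form, recorded by the form itself. -/
structure HilbSeminorm (V : Type*) [AddCommGroup V] [Module ℝ V] where
  bilin : V →ₗ[ℝ] V →ₗ[ℝ] ℝ
  symm : ∀ v w, bilin v w = bilin w v
  nonneg : ∀ v, 0 ≤ bilin v v

namespace HilbSeminorm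

variable {V W : Type*} [AddCommGroup V] [Module ℝ V] [AddCommGroup W] [Module ℝ W]

/-- The seminorm associated to a Hilbertian seminorm: `p v = √⟨v,v⟩ₚ`. -/
def toFun (p : HilbSeminorm V) (v : V) : ℝ := Real.sqrt (p.bilin v v)

/-- Pullback of a Hilbertian seminorm along a linear map (e.g. restriction to a
subspace along the inclusion). -/
def comp (p : HilbSeminorm V) (f : W →ₗ[ℝ] V) : HilbSeminorm W where
  bilin := LinearMap.compl₁₂ p.bilin f f
  symm v w := by
    simp only [LinearMap.compl₁₂_apply]
    exact p.symm (f v) (f w)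
  nonneg v := by
    simp only [LinearMap.compl₁₂_apply]
    exact p.nonneg (f v)

/-- The Hilbertian seminorm `c • p`, induced by the bilinear form `c² ⟨·,·⟩ₚ`. -/
def smul (p : HilbSeminorm V) (c : ℝ) : HilbSeminorm V where
  bilin := c ^ 2 • p.bilin
  symm v w := by
    simp only [LinearMap.smul_apply, smul_eq_mul]
    rw [p.symm v w]
  nonneg v := by
    simp only [LinearMap.smul_apply, smul_eq_mul]
    exact mul_nonneg (sq_nonneg c) (p.nonneg v)

/-- A finite subset `E ⊆ V` is `q`-orthonormal. -/
def IsONS (q : HilbSeminorm V) (E : Finset V) : Prop :=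
  (∀ e ∈ E, q.bilin e e = 1) ∧ ∀ e ∈ E, ∀ f ∈ E, e ≠ f → q.bilin e f = 0

open scoped Classical

/-- The trace `tr(p/q)` of a Hilbertian seminorm `p` with respect to a Hilbertian
seminorm `q`: the supremum over finite `q`-orthonormal sets `E` of `∑_{e∈E} p(e)²`
if `ker q ⊆ ker p`, and `∞` otherwise. -/
def trace (p q : HilbSeminorm V) : ℝ≥0∞ :=
  if ∀ v, q.bilin v v = 0 → p.bilin v v = 0 then
    ⨆ (E : Finset V) (_ : q.IsONS E), ENNReal.ofReal (∑ e ∈ E, p.bilin e e)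
  else ⊤

end HilbSeminorm

section AlgebraDefs

variable {A : Type*} [CommRing A] [Algebra ℝ A]

/-- The restriction `α|_V` of a character `α` is `q`-continuous. -/
def QContOn (V : Submodule ℝ A) (q : ↥V → ℝ) (α : Character A) : Prop :=
  ∃ C > 0, ∀ v : V, |α (v : A)| ≤ C * q v

/-- `J`: the family of all subalgebras of `A` generated by finite-dimensional
subspaces of `V`. -/
def finGenSubalgebras (V : Submodule ℝ A) : Set (Subalgebra ℝ A) :=
  {S | ∃ W : Submodule ℝ A, W ≤ V ∧ FiniteDimensional ℝ ↥W ∧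
    S = Algebra.adjoin ℝ (W : Set A)}

/-- The family `{ν_S : S ∈ J}` is `p`-concentrated. -/
def Concentrated (V : Submodule ℝ A) (J : Set (Subalgebra ℝ A)) (p : ↥V → ℝ)
    (ν : ∀ S : Subalgebra ℝ A, Measure (Character ↥S)) : Prop :=
  ∀ ε > (0 : ℝ), ∃ δ > (0 : ℝ), ∀ S ∈ J, ∀ v : V, ∀ hv : (v : A) ∈ S,
    p v ≤ δ → ν S {α : Character ↥S | 1 ≤ |α ⟨(v : A), hv⟩|} ≤ ENNReal.ofReal ε

/-- A quadratic module in `A`. -/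
def IsQuadraticModule (Q : Set A) : Prop :=
  (1 : A) ∈ Q ∧ (∀ x ∈ Q, ∀ y ∈ Q, x + y ∈ Q) ∧ ∀ a : A, ∀ x ∈ Q, a ^ 2 * x ∈ Q

/-- The nonnegativity set `K_Q ⊆ X(A)` of a quadratic module `Q`. -/
def charNonneg (Q : Set A) : Set (Character A) := {α | ∀ a ∈ Q, 0 ≤ α a}

/-- The nonnegativity set `K_{Q ∩ S} ⊆ X(S)` for a subalgebra `S`. -/
def charNonnegOn (Q : Set A) (S : Subalgebra ℝ A) : Set (Character ↥S) :=
  {α | ∀ a : S, (a : A) ∈ Q → 0 ≤ α a}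

/-- The Hilbertian seminorm `s_L(a) = √(L(a²))` induced by a `∑A²`-positive
linear functional `L`, via the bilinear form `(a,b) ↦ L(ab)`. -/
def sLSeminorm (L : A →ₗ[ℝ] ℝ) (hL : ∀ a : A, 0 ≤ L (a * a)) : HilbSeminorm A where
  bilin := (LinearMap.mul ℝ A).compr₂ L
  symm v w := by simp [mul_comm]
  nonneg v := by simpa using hL v

end AlgebraDefs

/-- `τ` is the topology induced by a directed family `P` of Hilbertian
seminorms. -/
def InducedByHilbFamily {V : Type*} [AddCommGroup V] [Module ℝ V]
    (τ : TopologicalSpace V) (P : Set (HilbSeminorm V)) : Prop :=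
  (∀ p ∈ P, ∀ q ∈ P, ∃ r ∈ P, ∀ v, p.toFun v ≤ r.toFun v ∧ q.toFun v ≤ r.toFun v) ∧
  ∀ v : V, (@nhds V τ v).HasBasis
    (fun pe : HilbSeminorm V × ℝ => pe.1 ∈ P ∧ 0 < pe.2)
    (fun pe => {w | pe.1.toFun (w - v) < pe.2})

/-- A topology is nuclear (in the sense of Yamasaki) if it is induced by a
directed family `P` of Hilbertian seminorms such that every `p ∈ P` admits
`q ∈ P` with `tr(p/q) < ∞`. -/
def IsNuclearTopology {V : Type*} [AddCommGroup V] [Module ℝ V]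
    (τ : TopologicalSpace V) : Prop :=
  ∃ P : Set (HilbSeminorm V), InducedByHilbFamily τ P ∧
    ∀ p ∈ P, ∃ q ∈ P, p.trace q < ⊤

end

section Helpers

open Filter Topology

section CharacterSpace

variable {A : Type*} [CommRing A] [Algebra ℝ A]

instance Character.instBorelSpace : BorelSpace (Character A) := ⟨rfl⟩

theorem Character.isEmbedding_coe :
    IsEmbedding (fun (α : Character A) (a : A) => α a) :=
  ⟨⟨rfl⟩, DFunLike.coe_injective⟩

instance Character.instT2Space : T2Space (Character A) :=
  Character.isEmbedding_coe.t2Space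

theorem Character.continuous_eval (a : A) : Continuous (fun α : Character A => α a) :=
  (continuous_apply a).comp Character.isEmbedding_coe.continuous

theorem Character.isClosed_range_coe :
    IsClosed (Set.range (fun (α : Character A) (a : A) => α a)) := by
  have : Set.range (fun (α : Character A) (a : A) => α a) =
      {y | ∀ a b, y (a + b) = y a + y b} ∩ {y | ∀ a b, y (a * b) = y a * y b} ∩
        {y | ∀ r : ℝ, y (algebraMap ℝ A r) = r} := by
    ext y
    constructor
    · rintro ⟨α, rfl⟩
      simp
    · rintro ⟨⟨hadd, hmul⟩, hr⟩
      refine ⟨{ toFun := y, map_one' := ?_, map_zero' := ?_, map_add' := hadd, map_mul' := hmul,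
                commutes' := hr }, rfl⟩
      · simpa using hr 1
      · simpa using hr 0
  rw [this]
  simp only [Set.ofPred_forall]
  refine ((isClosed_iInter fun a => isClosed_iInter fun b => ?_).inter
    (isClosed_iInter fun a => isClosed_iInter fun b => ?_)).inter (isClosed_iInter fun r => ?_)
  all_goals exact isClosed_eq (by fun_prop) (by fun_prop)

/-- A closed set of characters that is pointwise bounded is compact. -/
theorem Character.isCompact_of_bounded {K : Set (Character A)} (hK : IsClosed K)
    (hb : ∀ a, ∃ M : ℝ, ∀ α ∈ K, |α a| ≤ M) : IsCompact K := by
  choose M hM using hb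
  have hcl : IsClosedEmbedding (fun (α : Character A) (a : A) => α a) :=
    ⟨Character.isEmbedding_coe, Character.isClosed_range_coe⟩
  have hbox : IsCompact (Set.univ.pi fun a => Set.Icc (-M a) (M a)) :=
    isCompact_univ_pi fun a => isCompact_Icc
  refine (hcl.isCompact_preimage hbox).of_isClosed_subset hK fun α hα a _ => ?_
  exact abs_le.1 (hM a α hα)

/-- **Haviland's theorem** for compact sets of characters. -/
theorem Character.exists_measure_of_nonneg {K : Set (Character A)} (hK : IsCompact K)
    (l : A →ₗ[ℝ] ℝ) (hl : ∀ a, (∀ α ∈ K, 0 ≤ α a) → 0 ≤ l a) :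
    ∃ μ : Measure (Character A), IsFiniteMeasure μ ∧ μ.InnerRegular ∧ μ Kᶜ = 0 ∧
      ∀ a, ∫ α, α a ∂μ = l a := by
  have : CompactSpace K := isCompact_iff_compactSpace.mp hK
  let φ : A →ₗ[ℝ] CompactlySupportedContinuousMap K ℝ :=
    { toFun := fun a => ⟨⟨fun α => α.1 a,
        (Character.continuous_eval a).comp continuous_subtype_val⟩,
        HasCompactSupport.of_compactSpace _⟩
      map_add' := fun a b => by ext α; simp
      map_smul' := fun r a => by ext α; simp }
  have hφ : ∀ a (α : K), φ a α = α.1 a := fun _ _ => rfl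
  have hker : LinearMap.ker φ ≤ LinearMap.ker l := by
    intro a ha
    rw [LinearMap.mem_ker] at ha ⊢
    have h0 : ∀ α ∈ K, α a = 0 := fun α hα => by
      have := DFunLike.congr_fun ha ⟨α, hα⟩
      simpa [hφ] using this
    apply le_antisymm
    · have := hl (-a) fun α hα => by simp [h0 α hα]
      simpa using this
    · exact hl a fun α hα => (h0 α hα).ge
  obtain ⟨g, hg⟩ : l ∈ LinearMap.range φ.dualMap := by
    rw [LinearMap.range_dualMap_eq_dualAnnihilator_ker, Submodule.mem_dualAnnihilator]
    exact fun a ha => hker ha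
  have hg' : ∀ a, g (φ a) = l a := fun a => by rw [← hg]; rfl
  have : PosSMulMono ℝ (CompactlySupportedContinuousMap K ℝ) :=
    ⟨fun r hr f f' hf α => mul_le_mul_of_nonneg_left (hf α) hr⟩
  obtain ⟨Λ, hΛ, hΛpos⟩ := riesz_extension
    (PointedCone.positive ℝ (CompactlySupportedContinuousMap K ℝ))
    ⟨LinearMap.range φ, g.domRestrict _⟩
    (by
      rintro ⟨_, a, rfl⟩ ha
      change 0 ≤ g (φ a)
      rw [hg']
      exact hl a fun α hα => (ha : (0 : CompactlySupportedContinuousMap K ℝ) ≤ φ a) ⟨α, hα⟩)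
    (by
      intro y
      obtain ⟨C, hC⟩ := (isCompact_range y.continuous).isBounded.exists_norm_le
      refine ⟨⟨φ (algebraMap ℝ A C), _, rfl⟩, ?_⟩
      change (0 : CompactlySupportedContinuousMap K ℝ) ≤ φ (algebraMap ℝ A C) + y
      intro α
      have := abs_le.1 (hC (y α) ⟨α, rfl⟩)
      simp only [CompactlySupportedContinuousMap.coe_zero, Pi.zero_apply,
        CompactlySupportedContinuousMap.coe_add, Pi.add_apply, hφ, AlgHom.commutes]
      simp
      linarith)
  let Λ' : CompactlySupportedContinuousMap K ℝ →ₚ[ℝ] ℝ := PositiveLinearMap.mk₀ Λ hΛpos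
  refine ⟨(RealRMK.rieszMeasure Λ').map Subtype.val, inferInstance,
    Measure.InnerRegular.map_of_continuous continuous_subtype_val, ?_, fun a => ?_⟩
  · rw [Measure.map_apply continuous_subtype_val.measurable hK.measurableSet.compl]
    simp
  · rw [integral_map continuous_subtype_val.aemeasurable
      (Character.continuous_eval a).aestronglyMeasurable]
    calc ∫ α : K, α.1 a ∂(RealRMK.rieszMeasure Λ') = Λ' (φ a) :=
          RealRMK.integral_rieszMeasure Λ' (φ a)
      _ = g (φ a) := hΛ ⟨φ a, a, rfl⟩
      _ = l a := hg' a

end CharacterSpace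

section Approximation

variable {A : Type*} [CommRing A] [Algebra ℝ A] {ι : Type*} {Ω : ι → Type*}

/-- A family of real functions on `A` that is eventually compatible with each single instance of
the algebra operations. -/
structure IsApproxCharacter (U : Filter ι) (x : ∀ i, Ω i → A → ℝ) : Prop where
  add : ∀ a b, ∀ᶠ i in U, ∀ ω, x i ω (a + b) = x i ω a + x i ω b
  mul : ∀ a b, ∀ᶠ i in U, ∀ ω, x i ω (a * b) = x i ω a * x i ω b
  scalar : ∀ r : ℝ, ∀ᶠ i in U, ∀ ω, x i ω (algebraMap ℝ A r) = r

theorem IsApproxCharacter.smul {U : Filter ι} {x : ∀ i, Ω i → A → ℝ}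
    (hx : IsApproxCharacter U x) (r : ℝ) (a : A) :
    ∀ᶠ i in U, ∀ ω, x i ω (r • a) = r * x i ω a := by
  filter_upwards [hx.mul (algebraMap ℝ A r) a, hx.scalar r] with i h1 h2 ω
  rw [Algebra.smul_def, h1, h2]

theorem Ultrafilter.exists_tendsto_of_bounded (U : Ultrafilter ι) {f : ι → ℝ} {M : ℝ}
    (hf : ∀ᶠ i in U, |f i| ≤ M) : ∃ l, Tendsto f U (𝓝 l) := by
  obtain ⟨l, -, hl⟩ := (isCompact_Icc (a := -M) (b := M)).ultrafilter_le_nhds' (U.map f)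
    (hf.mono fun i hi => abs_le.1 hi)
  exact ⟨l, hl⟩

/-- The characters that are bounded by `c` along `f`. -/
def boundedCharacters {W : Type*} (f : W → A) (c : W → ℝ) : Set (Character A) :=
  {α | ∀ v, |α (f v)| ≤ c v}

theorem isClosed_boundedCharacters {W : Type*} (f : W → A) (c : W → ℝ) :
    IsClosed (boundedCharacters f c) := by
  have : boundedCharacters f c = ⋂ v, {α : Character A | |α (f v)| ≤ c v} := by
    ext; simp [boundedCharacters]
  rw [this]
  exact isClosed_iInter fun v =>
    isClosed_le (Character.continuous_eval (f v)).abs continuous_const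

theorem eventually_forall_neg_le {U : Ultrafilter ι} {x : ∀ i, Ω i → A → ℝ}
    (hx : IsApproxCharacter U x) {W : Type*} {f : W → A} {c : W → ℝ} {G : ∀ i, Set (Ω i)}
    (hGb : ∀ a, ∃ M, ∀ᶠ i in U, ∀ ω ∈ G i, |x i ω a| ≤ M)
    (hGc : ∀ v, ∀ᶠ i in U, ∀ ω ∈ G i, |x i ω (f v)| ≤ c v)
    {a : A} (ha : ∀ α ∈ boundedCharacters f c, 0 ≤ α a) {η : ℝ} (hη : 0 < η) :
    ∀ᶠ i in U, ∀ ω ∈ G i, -η ≤ x i ω a := by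
  by_contra hcon
  rw [← Ultrafilter.eventually_not] at hcon
  obtain ⟨y, hy⟩ : ∃ y : ι → A → ℝ, ∀ᶠ i in U, ∃ ω ∈ G i, y i = x i ω ∧ y i a < -η := by
    refine Eventually.choice (r := fun i z => ∃ ω ∈ G i, z = x i ω ∧ z a < -η)
      (hcon.mono fun i hi => ?_)
    push Not at hi
    obtain ⟨ω, hω, h⟩ := hi
    exact ⟨x i ω, ω, hω, rfl, h⟩
  have hlim : ∀ b, ∃ l, Tendsto (fun i => y i b) U (𝓝 l) := fun b => by
    obtain ⟨M, hM⟩ := hGb b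
    refine U.exists_tendsto_of_bounded (M := M) ?_
    filter_upwards [hM, hy] with i h1 ⟨ω, hω, h2, _⟩
    rw [h2]
    exact h1 ω hω
  choose χ hχ using hlim
  have halg : ∀ r : ℝ, χ (algebraMap ℝ A r) = r := fun r => by
    refine tendsto_nhds_unique (hχ _) (Tendsto.congr' ?_ tendsto_const_nhds)
    filter_upwards [hx.scalar r, hy] with i h1 ⟨ω, hω, h2, _⟩
    rw [h2, h1]
  let α : Character A :=
    { toFun := χ
      map_one' := by simpa using halg 1
      map_zero' := by simpa using halg 0
      map_add' := fun b b' => by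
        refine tendsto_nhds_unique (hχ _) (Tendsto.congr' ?_ ((hχ b).add (hχ b')))
        filter_upwards [hx.add b b', hy] with i h1 ⟨ω, hω, h2, _⟩
        rw [h2, h1]
      map_mul' := fun b b' => by
        refine tendsto_nhds_unique (hχ _) (Tendsto.congr' ?_ ((hχ b).mul (hχ b')))
        filter_upwards [hx.mul b b', hy] with i h1 ⟨ω, hω, h2, _⟩
        rw [h2, h1]
      commutes' := halg }
  have hα : α ∈ boundedCharacters f c := fun v => by
    refine le_of_tendsto (hχ (f v)).abs ?_
    filter_upwards [hGc v, hy] with i h1 ⟨ω, hω, h2, _⟩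
    rw [h2]
    exact h1 ω hω
  have h1 : χ a ≤ -η := le_of_tendsto (hχ a) (hy.mono fun i ⟨ω, _, _, h⟩ => h.le)
  have h2 : 0 ≤ χ a := ha α hα
  linarith

theorem Character.integrable_eval_of_isCompact {K : Set (Character A)} (hK : IsCompact K)
    {μ : Measure (Character A)} [IsFiniteMeasure μ] (hμ : μ Kᶜ = 0) (a : A) :
    Integrable (fun α : Character A => α a) μ := by
  obtain ⟨C, hC⟩ := hK.exists_bound_of_continuousOn (Character.continuous_eval a).continuousOn
  refine Integrable.of_bound (Character.continuous_eval a).aestronglyMeasurable C ?_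
  filter_upwards [compl_mem_ae_iff.2 hμ] with α hα
  exact hC α (by simpa using hα)

/-- The ultrafilter limit of approximate characters that are bounded is given by a measure on the
bounded characters. -/
theorem exists_measure_tendsto_setIntegral {U : Ultrafilter ι} [∀ i, MeasurableSpace (Ω i)]
    (P : ∀ i, Measure (Ω i)) [∀ i, IsProbabilityMeasure (P i)] {x : ∀ i, Ω i → A → ℝ}
    (hx : IsApproxCharacter U x) (hxm : ∀ i a, Measurable fun ω => x i ω a)
    {W : Type*} {f : W → A} {c : W → ℝ} (hK : IsCompact (boundedCharacters f c))
    {G D : ∀ i, Set (Ω i)}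
    (hGb : ∀ a, ∃ M, ∀ᶠ i in U, ∀ ω ∈ G i, |x i ω a| ≤ M)
    (hGc : ∀ v, ∀ᶠ i in U, ∀ ω ∈ G i, |x i ω (f v)| ≤ c v)
    (hD : ∀ i, MeasurableSet (D i)) (hDG : ∀ i, D i ⊆ G i) :
    ∃ μ : Measure (Character A), IsFiniteMeasure μ ∧ μ.InnerRegular ∧
      μ (boundedCharacters f c)ᶜ = 0 ∧
      ∀ a, Tendsto (fun i => ∫ ω in D i, x i ω a ∂P i) U (𝓝 (∫ α, α a ∂μ)) := by
  have hlim : ∀ a, ∃ l, Tendsto (fun i => ∫ ω in D i, x i ω a ∂P i) U (𝓝 l) := fun a => by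
    obtain ⟨M, hM⟩ := hGb a
    refine U.exists_tendsto_of_bounded (M := |M|) ?_
    filter_upwards [hM] with i hi
    have h1 := norm_setIntegral_le_of_norm_le_const (measure_lt_top (P i) (D i))
      (f := fun ω => x i ω a) (C := |M|) (fun ω hω => (hi ω (hDG i hω)).trans (le_abs_self M))
    refine h1.trans ?_
    exact mul_le_of_le_one_right (abs_nonneg M) measureReal_le_one
  have hint : ∀ a, ∀ᶠ i in U, IntegrableOn (fun ω => x i ω a) (D i) (P i) := fun a => by
    obtain ⟨M, hM⟩ := hGb a
    filter_upwards [hM] with i hi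
    refine Measure.integrableOn_of_bounded (M := M) (measure_ne_top _ _)
      (hxm i a).aestronglyMeasurable ?_
    filter_upwards [ae_restrict_mem (hD i)] with ω hω using hi ω (hDG i hω)
  choose l hl using hlim
  let l' : A →ₗ[ℝ] ℝ :=
    { toFun := l
      map_add' := fun a b => by
        refine tendsto_nhds_unique (hl _) (Tendsto.congr' ?_ ((hl a).add (hl b)))
        filter_upwards [hx.add a b, hint a, hint b] with i h1 h2 h3
        simp_rw [h1]
        exact (integral_add h2 h3).symm
      map_smul' := fun r a => by
        refine tendsto_nhds_unique (hl _) (Tendsto.congr' ?_ ((hl a).const_mul r))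
        filter_upwards [hx.smul r a] with i h1
        simp_rw [h1]
        exact (integral_const_mul _ _).symm }
  obtain ⟨μ, hμ1, hμ2, hμ3, hμ4⟩ := Character.exists_measure_of_nonneg hK l' fun a ha => by
    refine le_of_forall_pos_le_add fun η hη => ?_
    suffices -η ≤ l a by
      change 0 ≤ l a + η
      linarith
    refine ge_of_tendsto (hl a) ?_
    filter_upwards [eventually_forall_neg_le hx hGb hGc ha hη, hint a] with i hi h2
    have h1 : ∫ ω in D i, -η ∂P i ≤ ∫ ω in D i, x i ω a ∂P i :=
      setIntegral_mono_on (integrableOn_const (measure_ne_top _ _)) h2 (hD i)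
        fun ω hω => hi ω (hDG i hω)
    refine le_trans ?_ h1
    rw [setIntegral_const, smul_eq_mul]
    nlinarith [measureReal_le_one (μ := P i) (s := D i)]
  exact ⟨μ, hμ1, hμ2, hμ3, fun a => by rw [hμ4]; exact hl a⟩

end Approximation

section Approximation

variable {A : Type*} [CommRing A] [Algebra ℝ A] {ι : Type*} {Ω : ι → Type*}

theorem abs_le_mul_sq_add_inv {η : ℝ} (hη : 0 < η) (t : ℝ) : |t| ≤ η * t ^ 2 + η⁻¹ := by
  have h : 0 ≤ η⁻¹ * ((η * |t| - 1) ^ 2 + η * |t|) := by positivity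
  have h2 : η⁻¹ * ((η * |t| - 1) ^ 2 + η * |t|) = η * t ^ 2 + η⁻¹ - |t| := by
    rw [← sq_abs t]
    field_simp
    ring
  linarith

theorem integrable_of_integrable_sq {X : Type*} [MeasurableSpace X] {μ : Measure X}
    [IsFiniteMeasure μ] {f : X → ℝ} (hf : AEStronglyMeasurable f μ)
    (h : Integrable (fun ω => f ω ^ 2) μ) : Integrable f μ := by
  refine ((h.const_mul 1).add (integrable_const 1⁻¹)).mono' hf (ae_of_all _ fun ω => ?_)
  exact abs_le_mul_sq_add_inv one_pos (f ω)

/-- If approximate characters represent `L` in the limit and are uniformly concentrated on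
bounded sets, then `L` is represented by a Radon measure on the bounded characters. -/
theorem exists_measure_of_isApproxCharacter {U : Ultrafilter ι} [∀ i, MeasurableSpace (Ω i)]
    (P : ∀ i, Measure (Ω i)) [∀ i, IsProbabilityMeasure (P i)] {x : ∀ i, Ω i → A → ℝ}
    (hx : IsApproxCharacter U x) (hxm : ∀ i a, Measurable fun ω => x i ω a) (L : A →ₗ[ℝ] ℝ)
    (hL : ∀ a, ∀ᶠ i in U, Integrable (fun ω => x i ω a) (P i) ∧ ∫ ω, x i ω a ∂P i = L a)
    {W : Type*} {f : W → A} {c : ℕ → W → ℝ} (hK : ∀ n, IsCompact (boundedCharacters f (c n)))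
    {G : ℕ → ∀ i, Set (Ω i)}
    (hGb : ∀ n a, ∃ M, ∀ᶠ i in U, ∀ ω ∈ G n i, |x i ω a| ≤ M)
    (hGc : ∀ n v, ∀ᶠ i in U, ∀ ω ∈ G n i, |x i ω (f v)| ≤ c n v)
    (hGm : ∀ n i, MeasurableSet (G n i)) (hGmono : ∀ i, Monotone fun n => G n i)
    (hG : ∀ ε > 0, ∃ n, ∀ᶠ i in U, (P i).real (G n i)ᶜ ≤ ε) :
    ∃ ν : Measure (Character A), IsProbabilityMeasure ν ∧ ν.InnerRegular ∧
      (∀ a, ∫ α, α a ∂ν = L a) ∧ ν (⋃ n, boundedCharacters f (c n))ᶜ = 0 := by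
  have hex : ∀ n, ∃ μ : Measure (Character A), IsFiniteMeasure μ ∧ μ.InnerRegular ∧
      μ (boundedCharacters f (c n))ᶜ = 0 ∧
      ∀ a, Tendsto (fun i => ∫ ω in disjointed (fun n => G n i) n, x i ω a ∂P i) U
        (𝓝 (∫ α, α a ∂μ)) := fun n =>
    exists_measure_tendsto_setIntegral P hx hxm (hK n) (hGb n) (hGc n)
      (fun i => MeasurableSet.disjointed (fun n => hGm n i) n) (fun i => disjointed_subset _ n)
  choose μ hfin hreg hnull hμ using hex
  have hμint : ∀ n a, Integrable (fun α : Character A => α a) (μ n) := fun n a =>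
    Character.integrable_eval_of_isCompact (hK n) (hnull n) a
  have hμsum : ∀ N a, Integrable (fun α : Character A => α a)
      (∑ n ∈ Finset.range (N + 1), μ n) := fun N a =>
    integrable_finsetSum_measure.2 fun n _ => hμint n a
  have hsum : ∀ N a, Tendsto (fun i => ∫ ω in G N i, x i ω a ∂P i) U
      (𝓝 (∫ α, α a ∂(∑ n ∈ Finset.range (N + 1), μ n))) := fun N a => by
    rw [integral_finsetSum_measure fun n _ => hμint n a]
    refine Tendsto.congr' ?_ (tendsto_finsetSum _ fun n _ => hμ n a)
    filter_upwards [hL a] with i hi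
    rw [← integral_biUnion_finset _ (fun n _ => MeasurableSet.disjointed (fun n => hGm n i) n)
      ((disjoint_disjointed fun n => G n i).set_pairwise _) fun n _ => hi.1.integrableOn,
      biUnion_range_succ_disjointed, (hGmono i).partialSups_eq]
  have hle : ∀ N a, ∫ α, α (a ^ 2) ∂(∑ n ∈ Finset.range (N + 1), μ n) ≤ L (a ^ 2) :=
    fun N a => by
    refine le_of_tendsto (hsum N (a ^ 2)) ?_
    filter_upwards [hL (a ^ 2), hx.mul a a] with i hi h1
    rw [← hi.2]
    refine setIntegral_le_integral hi.1 (ae_of_all _ fun ω => ?_)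
    simp only [pow_two, h1, Pi.zero_apply]
    exact mul_self_nonneg _
  have hclose : ∀ a, ∀ e > 0, ∃ N₀, ∀ N ≥ N₀,
      |∫ α, α a ∂(∑ n ∈ Finset.range (N + 1), μ n) - L a| ≤ e := fun a e he => by
    have hLa : 0 ≤ L (a ^ 2) := by
      refine le_trans ?_ (hle 0 a)
      exact integral_nonneg fun α => by simpa using sq_nonneg (α a)
    set η := e / (L (a ^ 2) + 1)
    have hη : 0 < η := by positivity
    obtain ⟨N₀, hN₀⟩ := hG (η ^ 2) (by positivity)
    refine ⟨N₀, fun N hN => ?_⟩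
    refine le_of_tendsto ((hsum N a).sub_const (L a)).abs ?_
    filter_upwards [hL a, hL (a ^ 2), hx.mul a a, hN₀] with i h1 h2 h3 h4
    have h5 : (P i).real (G N i)ᶜ ≤ η ^ 2 :=
      (measureReal_mono (Set.compl_subset_compl.2 (hGmono i hN))).trans h4
    have h6 : ∫ ω in G N i, x i ω a ∂P i - L a = -∫ ω in (G N i)ᶜ, x i ω a ∂P i := by
      rw [← h1.2, ← integral_add_compl (hGm N i) h1.1]
      ring
    have h7 : Integrable (fun ω => η * x i ω (a ^ 2) + η⁻¹) (P i) :=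
      (h2.1.const_mul η).add (integrable_const _)
    rw [h6, abs_neg]
    calc |∫ ω in (G N i)ᶜ, x i ω a ∂P i|
        ≤ ∫ ω in (G N i)ᶜ, |x i ω a| ∂P i := abs_integral_le_integral_abs
      _ ≤ ∫ ω in (G N i)ᶜ, (η * x i ω (a ^ 2) + η⁻¹) ∂P i := by
          refine setIntegral_mono h1.1.abs.integrableOn h7.integrableOn fun ω => ?_
          simpa only [pow_two, h3] using abs_le_mul_sq_add_inv hη (x i ω a)
      _ = η * ∫ ω in (G N i)ᶜ, x i ω (a ^ 2) ∂P i + η⁻¹ * (P i).real (G N i)ᶜ := by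
          rw [integral_add (h2.1.const_mul η).integrableOn (integrable_const _),
            integral_const_mul, setIntegral_const, smul_eq_mul, mul_comm η⁻¹]
      _ ≤ η * L (a ^ 2) + η⁻¹ * η ^ 2 := by
          gcongr
          rw [← h2.2]
          refine setIntegral_le_integral h2.1 (ae_of_all _ fun ω => ?_)
          simp only [pow_two, h3, Pi.zero_apply]
          exact mul_self_nonneg _
      _ = η * (L (a ^ 2) + 1) := by field_simp
      _ = e := by simp only [η]; field_simp
  have hmono : ∀ N, ∑ n ∈ Finset.range N, μ n ≤ ∑ n ∈ Finset.range (N + 1), μ n := fun N => by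
    rw [Finset.sum_range_succ]
    exact Measure.le_add_right le_rfl
  have hL1 : L 1 = 1 := by
    obtain ⟨i, hi, h1⟩ := ((hL 1).and (hx.scalar 1)).exists
    rw [← hi.2]
    simp only [map_one] at h1
    simp [h1]
  have hreal : ∀ N, ∫ α : Character A, α (1 : A) ∂(∑ n ∈ Finset.range (N + 1), μ n) =
      (∑ n ∈ Finset.range (N + 1), μ n).real Set.univ := fun N => by simp
  have hltop : ∀ N, (∑ n ∈ Finset.range N, μ n) Set.univ ≠ ⊤ := fun N => by
    rw [Measure.finsetSum_apply]
    exact (ENNReal.sum_lt_top.2 fun n _ => measure_lt_top (μ n) _).ne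
  have hmass : (Measure.sum μ) Set.univ = 1 := by
    rw [Measure.sum_apply _ MeasurableSet.univ]
    apply le_antisymm
    · rw [ENNReal.tsum_eq_iSup_nat]
      refine iSup_le fun N => ?_
      rw [← Measure.finsetSum_apply]
      refine (hmono N _).trans ?_
      rw [← ENNReal.ofReal_toReal (hltop (N + 1)), ← ENNReal.ofReal_one, ← hL1]
      refine ENNReal.ofReal_le_ofReal ?_
      have := hle N 1
      rw [one_pow, hreal] at this
      exact this
    · refine ENNReal.le_of_forall_pos_le_add fun e he _ => ?_
      obtain ⟨N, hN⟩ := hclose 1 e he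
      have h1 := hN N le_rfl
      rw [hreal, hL1, abs_le] at h1
      have h2 : (∑ n ∈ Finset.range (N + 1), μ n) Set.univ ≤ ∑' n, μ n Set.univ := by
        rw [Measure.finsetSum_apply]
        exact ENNReal.sum_le_tsum _
      refine le_trans ?_ (add_le_add_left h2 _)
      rw [← ENNReal.ofReal_toReal (hltop (N + 1)), ← ENNReal.ofReal_coe_nnreal,
        ← ENNReal.ofReal_add ENNReal.toReal_nonneg e.coe_nonneg, ← ENNReal.ofReal_one]
      refine ENNReal.ofReal_le_ofReal ?_
      have h3 := h1.1
      rw [measureReal_def] at h3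
      linarith
  have hprob : IsProbabilityMeasure (Measure.sum μ) := ⟨hmass⟩
  have hsq : ∀ a, Integrable (fun α : Character A => α (a ^ 2)) (Measure.sum μ) := fun a => by
    refine ⟨(Character.continuous_eval _).aestronglyMeasurable, ?_⟩
    rw [hasFiniteIntegral_iff_ofReal (ae_of_all _ fun α => by simpa using sq_nonneg (α a)),
      lintegral_sum_measure]
    refine lt_of_le_of_lt ?_ (ENNReal.ofReal_lt_top (r := L (a ^ 2)))
    rw [ENNReal.tsum_eq_iSup_nat]
    refine iSup_le fun N => ?_
    rw [← lintegral_finsetSum_measure]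
    refine (lintegral_mono' (hmono N) le_rfl).trans ?_
    rw [← ofReal_integral_eq_lintegral_ofReal (hμsum N _)
      (ae_of_all _ fun α => by simpa using sq_nonneg (α a))]
    exact ENNReal.ofReal_le_ofReal (hle N a)
  have hint : ∀ a, Integrable (fun α : Character A => α a) (Measure.sum μ) := fun a =>
    integrable_of_integrable_sq (Character.continuous_eval a).aestronglyMeasurable
      (by simpa using hsq a)
  refine ⟨Measure.sum μ, hprob, inferInstance, fun a => ?_, ?_⟩
  · have h1 := (hasSum_integral_measure (hint a)).tendsto_sum_nat.comp (tendsto_add_atTop_nat 1)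
    refine tendsto_nhds_unique h1 (Metric.tendsto_atTop.2 fun e he => ?_)
    obtain ⟨N₀, hN₀⟩ := hclose a (e / 2) (half_pos he)
    refine ⟨N₀, fun N hN => ?_⟩
    have h2 := hN₀ N hN
    rw [integral_finsetSum_measure fun n _ => hμint n a] at h2
    rw [Real.dist_eq]
    exact h2.trans_lt (half_lt_self he)
  · rw [Measure.sum_apply_eq_zero]
    intro n
    refine measure_mono_null (Set.compl_subset_compl.2 ?_) (hnull n)
    exact Set.subset_iUnion (fun n => boundedCharacters f (c n)) n

end Approximation

section SignedSum

variable {I M : Type*} [DecidableEq I] [AddCommGroup M]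

/-- The sum of `y` over `s` with sign `+` on `T` and sign `-` off `T`. -/
def signedSum (s T : Finset I) (y : I → M) : M := ∑ e ∈ s, if e ∈ T then y e else -y e

theorem signedSum_insert {s T : Finset I} {a : I} (ha : a ∉ s) (hT : T ⊆ s) (y : I → M) :
    signedSum (insert a s) T y = signedSum s T y - y a := by
  have : a ∉ T := fun h => ha (hT h)
  simp only [signedSum, Finset.sum_insert ha, if_neg this]
  abel

theorem signedSum_insert_insert {s T : Finset I} {a : I} (ha : a ∉ s) (y : I → M) :
    signedSum (insert a s) (insert a T) y = signedSum s T y + y a := by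
  rw [signedSum, Finset.sum_insert ha, if_pos (Finset.mem_insert_self a T), add_comm, signedSum]
  congr 1
  refine Finset.sum_congr rfl fun e he => ?_
  have : e ≠ a := fun h => ha (h ▸ he)
  simp [this]

theorem sum_powerset_signedSum [Module ℝ M] (s : Finset I) (y : I → M) (B : M →ₗ[ℝ] M →ₗ[ℝ] ℝ) :
    ∑ T ∈ s.powerset, B (signedSum s T y) (signedSum s T y) =
      2 ^ s.card * ∑ e ∈ s, B (y e) (y e) := by
  induction s using Finset.induction_on with
  | empty => simp [signedSum]
  | insert a s ha ih =>
    rw [Finset.sum_powerset_insert ha, ← Finset.sum_add_distrib, Finset.card_insert_of_notMem ha,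
      Finset.sum_insert ha]
    calc _ = ∑ T ∈ s.powerset,
          (2 * B (signedSum s T y) (signedSum s T y) + 2 * B (y a) (y a)) := by
          refine Finset.sum_congr rfl fun T hT => ?_
          rw [signedSum_insert ha (Finset.mem_powerset.1 hT), signedSum_insert_insert ha]
          simp only [map_sub, map_add, LinearMap.sub_apply, LinearMap.add_apply]
          ring
      _ = _ := by
          rw [Finset.sum_add_distrib, ← Finset.mul_sum, ih, Finset.sum_const,
            Finset.card_powerset, nsmul_eq_mul]
          push_cast
          ring

theorem sum_powerset_signedSum_sq (s : Finset I) (y : I → ℝ) :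
    ∑ T ∈ s.powerset, signedSum s T y ^ 2 = 2 ^ s.card * ∑ e ∈ s, y e ^ 2 := by
  simpa [pow_two] using sum_powerset_signedSum s y (LinearMap.mul ℝ ℝ)

theorem sum_powerset_signedSum_pow_four_le (s : Finset I) (y : I → ℝ) :
    ∑ T ∈ s.powerset, signedSum s T y ^ 4 ≤ 3 * 2 ^ s.card * (∑ e ∈ s, y e ^ 2) ^ 2 := by
  induction s using Finset.induction_on with
  | empty => simp [signedSum]
  | insert a s ha ih =>
    rw [Finset.sum_powerset_insert ha, ← Finset.sum_add_distrib, Finset.card_insert_of_notMem ha,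
      Finset.sum_insert ha]
    calc _ = ∑ T ∈ s.powerset,
          (2 * signedSum s T y ^ 4 + 12 * y a ^ 2 * signedSum s T y ^ 2 + 2 * y a ^ 4) := by
          refine Finset.sum_congr rfl fun T hT => ?_
          rw [signedSum_insert ha (Finset.mem_powerset.1 hT), signedSum_insert_insert ha]
          ring
      _ = 2 * ∑ T ∈ s.powerset, signedSum s T y ^ 4 +
          12 * y a ^ 2 * (2 ^ s.card * ∑ e ∈ s, y e ^ 2) + 2 ^ s.card * (2 * y a ^ 4) := by
          rw [Finset.sum_add_distrib, Finset.sum_add_distrib, ← Finset.mul_sum, ← Finset.mul_sum,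
            sum_powerset_signedSum_sq, Finset.sum_const, Finset.card_powerset, nsmul_eq_mul]
          push_cast
          ring
      _ ≤ 2 * (3 * 2 ^ s.card * (∑ e ∈ s, y e ^ 2) ^ 2) +
          12 * y a ^ 2 * (2 ^ s.card * ∑ e ∈ s, y e ^ 2) + 2 ^ s.card * (2 * y a ^ 4) := by
          gcongr
      _ ≤ _ := by
          have : (0 : ℝ) ≤ 2 ^ s.card * y a ^ 4 := by positivity
          rw [pow_succ (2 : ℝ)]
          linarith

/-- A Paley–Zygmund inequality for Rademacher sums. -/
theorem card_signedSum_ge (s : Finset I) (y : I → ℝ) (hy : 4 ≤ ∑ e ∈ s, y e ^ 2) :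
    3 / 14 * 2 ^ s.card ≤ ∑ T ∈ s.powerset, if 1 ≤ |signedSum s T y| then (1 : ℝ) else 0 := by
  set σ := ∑ e ∈ s, y e ^ 2 with hσ
  have hσ0 : 0 < σ := by linarith
  have key : ∀ T ∈ s.powerset, 4 / 7 * (σ⁻¹ * signedSum s T y ^ 2) -
      1 / 14 * (σ⁻¹ ^ 2 * signedSum s T y ^ 4) - 1 / 7 ≤
        if 1 ≤ |signedSum s T y| then (1 : ℝ) else 0 := by
    intro T _
    set z := σ⁻¹ * signedSum s T y ^ 2 with hz
    have hz2 : σ⁻¹ ^ 2 * signedSum s T y ^ 4 = z ^ 2 := by rw [hz]; ring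
    rw [hz2]
    split_ifs with h
    · nlinarith [sq_nonneg (z - 4)]
    · have h1 : signedSum s T y ^ 2 ≤ 1 := (sq_le_one_iff_abs_le_one _).2 (not_le.1 h).le
      have h2 : z ≤ 1 / 4 := by
        rw [hz, inv_mul_le_iff₀ hσ0]
        linarith
      nlinarith [sq_nonneg z]
  refine le_trans ?_ (Finset.sum_le_sum key)
  rw [Finset.sum_sub_distrib, Finset.sum_sub_distrib, ← Finset.mul_sum, ← Finset.mul_sum,
    ← Finset.mul_sum, ← Finset.mul_sum, sum_powerset_signedSum_sq, Finset.sum_const,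
    Finset.card_powerset, nsmul_eq_mul, ← hσ]
  have h4 : σ⁻¹ ^ 2 * ∑ T ∈ s.powerset, signedSum s T y ^ 4 ≤ 3 * 2 ^ s.card := by
    calc _ ≤ σ⁻¹ ^ 2 * (3 * 2 ^ s.card * σ ^ 2) := by
          gcongr
          exact sum_powerset_signedSum_pow_four_le s y
      _ = _ := by field_simp
  have h2 : σ⁻¹ * (2 ^ s.card * σ) = 2 ^ s.card := by field_simp
  rw [h2]
  push_cast
  linarith

theorem measureReal_four_le_sum_sq_le {Ω : Type*} [MeasurableSpace Ω] (μ : Measure Ω)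
    [IsProbabilityMeasure μ] (s : Finset I) {Y : I → Ω → ℝ} (hY : ∀ e, Measurable (Y e))
    {b : Finset I → ℝ}
    (hb : ∀ T, T ⊆ s → μ.real {ω | 1 ≤ |signedSum s T fun e => Y e ω|} ≤ b T) :
    3 / 14 * 2 ^ s.card * μ.real {ω | 4 ≤ ∑ e ∈ s, Y e ω ^ 2} ≤ ∑ T ∈ s.powerset, b T := by
  have hm1 : MeasurableSet {ω | 4 ≤ ∑ e ∈ s, Y e ω ^ 2} :=
    measurableSet_le measurable_const (Finset.measurable_fun_sum _ fun e _ => (hY e).pow_const 2)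
  have hm2 : ∀ T, MeasurableSet {ω | 1 ≤ |signedSum s T fun e => Y e ω|} := fun T => by
    refine measurableSet_le measurable_const (Measurable.abs ?_)
    refine Finset.measurable_fun_sum _ fun e _ => ?_
    split_ifs
    exacts [hY e, (hY e).neg]
  have hint : ∀ T ∈ s.powerset, Integrable
      ({ω | 1 ≤ |signedSum s T fun e => Y e ω|}.indicator fun _ => (1 : ℝ)) μ :=
    fun T _ => (integrable_const 1).indicator (hm2 T)
  calc 3 / 14 * 2 ^ s.card * μ.real {ω | 4 ≤ ∑ e ∈ s, Y e ω ^ 2}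
      = ∫ ω, {ω | 4 ≤ ∑ e ∈ s, Y e ω ^ 2}.indicator
          (fun _ => (3 / 14 * 2 ^ s.card : ℝ)) ω ∂μ := by
        rw [integral_indicator_const _ hm1, smul_eq_mul, mul_comm]
    _ ≤ ∫ ω, ∑ T ∈ s.powerset,
          {ω | 1 ≤ |signedSum s T fun e => Y e ω|}.indicator (fun _ => (1 : ℝ)) ω ∂μ := by
        refine integral_mono ((integrable_const _).indicator hm1)
          (integrable_finsetSum _ hint) fun ω => ?_
        by_cases hω : 4 ≤ ∑ e ∈ s, Y e ω ^ 2
        · simp only [Set.indicator_apply, Set.mem_ofPred_eq, hω, if_true]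
          exact card_signedSum_ge s (fun e => Y e ω) hω
        · rw [Set.indicator_of_notMem (by exact hω)]
          exact Finset.sum_nonneg fun T _ => Set.indicator_nonneg (fun _ _ => zero_le_one) ω
    _ = ∑ T ∈ s.powerset, μ.real {ω | 1 ≤ |signedSum s T fun e => Y e ω|} := by
        rw [integral_finsetSum _ hint]
        refine Finset.sum_congr rfl fun T _ => ?_
        rw [integral_indicator_const _ (hm2 T), smul_eq_mul, mul_one]
    _ ≤ _ := Finset.sum_le_sum fun T hT => hb T (Finset.mem_powerset.1 hT)

end SignedSum

namespace HilbSeminorm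

variable {V : Type*} [AddCommGroup V] [Module ℝ V]

theorem bilin_eq_zero_of_right (q : HilbSeminorm V) (v : V) {n : V} (hn : q.bilin n n = 0) :
    q.bilin v n = 0 := by
  by_contra h
  have h1 := q.nonneg (v + (-(q.bilin v v + 1) / (2 * q.bilin v n)) • n)
  simp only [map_add, map_smul, LinearMap.add_apply, LinearMap.smul_apply, smul_eq_mul, hn,
    q.symm n v] at h1
  have h2 : -(q.bilin v v + 1) / (2 * q.bilin v n) * q.bilin v n = -(q.bilin v v + 1) / 2 := by
    field_simp
  rw [h2] at h1
  linarith

theorem bilin_self_eq_of_sub (q : HilbSeminorm V) {v w : V}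
    (h : q.bilin (v - w) (v - w) = 0) : q.bilin v v = q.bilin w w := by
  have h1 := q.bilin_eq_zero_of_right v h
  have h2 := q.bilin_eq_zero_of_right w h
  simp only [map_sub] at h1 h2
  rw [q.symm w v] at h2
  linarith

theorem IsONS.bilin_sum {q : HilbSeminorm V} {E : Finset V} (hE : q.IsONS E) (c : V → ℝ) :
    q.bilin (∑ e ∈ E, c e • e) (∑ e ∈ E, c e • e) = ∑ e ∈ E, c e ^ 2 := by
  simp only [map_sum, LinearMap.sum_apply, map_smul, LinearMap.smul_apply, smul_eq_mul]
  refine Finset.sum_congr rfl fun e he => ?_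
  rw [Finset.sum_eq_single e]
  · rw [hE.1 e he]; ring
  · intro f hf hfe
    rw [hE.2 f hf e he hfe]; ring
  · exact fun h => (h he).elim

theorem IsONS.sum_bilin_le_trace {p q : HilbSeminorm V} {E : Finset V} (hE : q.IsONS E)
    (hpq : p.trace q < ⊤) : ∑ e ∈ E, p.bilin e e ≤ (p.trace q).toReal := by
  have h0 : 0 ≤ ∑ e ∈ E, p.bilin e e := Finset.sum_nonneg fun e _ => p.nonneg e
  rw [← ENNReal.toReal_ofReal h0]
  refine ENNReal.toReal_mono hpq.ne ?_
  rw [trace] at hpq ⊢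
  split_ifs at hpq ⊢ with h
  · exact le_iSup₂ (f := fun (E : Finset V) (_ : q.IsONS E) =>
      ENNReal.ofReal (∑ e ∈ E, p.bilin e e)) E hE
  · exact le_top

theorem bilin_eq_zero_of_trace_lt_top {p q : HilbSeminorm V} (hpq : p.trace q < ⊤) {v : V}
    (hv : q.bilin v v = 0) : p.bilin v v = 0 := by
  rw [trace] at hpq
  split_ifs at hpq with h
  · exact h v hv
  · exact (lt_irrefl _ hpq).elim

/-- Gram–Schmidt orthonormalization for a Hilbertian seminorm. -/
theorem exists_isONS (q : HilbSeminorm V) (F : Finset V) :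
    ∃ E : Finset V, q.IsONS E ∧ (∀ e ∈ E, e ∈ Submodule.span ℝ (F : Set V)) ∧
      ∀ v ∈ F, ∃ w ∈ Submodule.span ℝ (E : Set V), q.bilin (v - w) (v - w) = 0 := by
  classical
  induction F using Finset.induction_on with
  | empty => exact ⟨∅, ⟨by simp, by simp⟩, by simp, by simp⟩
  | insert v F hv ih =>
    obtain ⟨E, hE, hEF, hF⟩ := ih
    have hsub : Submodule.span ℝ (F : Set V) ≤ Submodule.span ℝ ((insert v F : Finset V) : Set V) :=
      Submodule.span_mono (by simp)
    set w := ∑ e ∈ E, q.bilin e v • e with hw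
    have hwE : w ∈ Submodule.span ℝ (E : Set V) :=
      Submodule.sum_mem _ fun e he => Submodule.smul_mem _ _ (Submodule.subset_span he)
    have hwF : w ∈ Submodule.span ℝ ((insert v F : Finset V) : Set V) :=
      Submodule.sum_mem _ fun e he => Submodule.smul_mem _ _ (hsub (hEF e he))
    have horth : ∀ e ∈ E, q.bilin e (v - w) = 0 := fun e he => by
      rw [map_sub, hw, map_sum, Finset.sum_eq_single e]
      · rw [map_smul, hE.1 e he, smul_eq_mul, mul_one, sub_self]
      · intro f hf hfe
        rw [map_smul, hE.2 e he f hf hfe.symm, smul_zero]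
      · exact fun h => (h he).elim
    by_cases h0 : q.bilin (v - w) (v - w) = 0
    · refine ⟨E, hE, fun e he => hsub (hEF e he), fun u hu => ?_⟩
      rcases Finset.mem_insert.1 hu with rfl | hu
      · exact ⟨w, hwE, h0⟩
      · exact hF u hu
    · set r := Real.sqrt (q.bilin (v - w) (v - w)) with hr
      have hr2 : r ^ 2 = q.bilin (v - w) (v - w) := Real.sq_sqrt (q.nonneg _)
      have hr0 : r ≠ 0 := fun h => h0 (by rw [← hr2, h]; ring)
      have h1 : q.bilin (r⁻¹ • (v - w)) (r⁻¹ • (v - w)) = 1 := by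
        simp only [map_smul, LinearMap.smul_apply, smul_eq_mul]
        rw [← hr2]
        field_simp
      have h2 : ∀ e ∈ E, q.bilin e (r⁻¹ • (v - w)) = 0 := fun e he => by
        rw [map_smul, horth e he, smul_zero]
      refine ⟨insert (r⁻¹ • (v - w)) E, ⟨?_, ?_⟩, ?_, ?_⟩
      · intro e he
        rcases Finset.mem_insert.1 he with rfl | he
        exacts [h1, hE.1 e he]
      · intro e he f hf hef
        rcases Finset.mem_insert.1 he with rfl | he <;> rcases Finset.mem_insert.1 hf with rfl | hf
        · exact (hef rfl).elim
        · rw [q.symm, h2 f hf]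
        · exact h2 e he
        · exact hE.2 e he f hf hef
      · intro e he
        rcases Finset.mem_insert.1 he with rfl | he
        · exact Submodule.smul_mem _ _ (Submodule.sub_mem _ (Submodule.subset_span (by simp)) hwF)
        · exact hsub (hEF e he)
      · have hsubE : Submodule.span ℝ (E : Set V) ≤
            Submodule.span ℝ ((insert (r⁻¹ • (v - w)) E : Finset V) : Set V) :=
          Submodule.span_mono (by simp)
        intro u hu
        rcases Finset.mem_insert.1 hu with rfl | hu
        · refine ⟨u, ?_, by simp⟩
          have h3 : u = r • (r⁻¹ • (u - w)) + w := by
            rw [smul_smul, mul_inv_cancel₀ hr0, one_smul, sub_add_cancel]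
          nth_rewrite 2 [h3]
          exact Submodule.add_mem _
            (Submodule.smul_mem _ _ (Submodule.subset_span (by simp))) (hsubE hwE)
        · obtain ⟨w', hw', h⟩ := hF u hu
          exact ⟨w', hsubE hw', h⟩

end HilbSeminorm

section Evaluation

variable {A : Type*} [CommRing A] [Algebra ℝ A]

open Classical in
/-- Evaluation of a character of a subalgebra `S`, extended by zero outside `S`. -/
noncomputable def Subalgebra.evalChar (S : Subalgebra ℝ A) (α : Character S) (a : A) : ℝ :=
  if h : a ∈ S then α ⟨a, h⟩ else 0

namespace Subalgebra

variable (S : Subalgebra ℝ A)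

theorem evalChar_of_mem (α : Character S) {a : A} (h : a ∈ S) : S.evalChar α a = α ⟨a, h⟩ :=
  dif_pos h

theorem setOf_one_le_abs_eq {a : A} (h : a ∈ S) :
    {α : Character S | 1 ≤ |α ⟨a, h⟩|} = {α | 1 ≤ |S.evalChar α a|} := by
  ext α
  simp only [Set.mem_ofPred_eq, S.evalChar_of_mem α h]

theorem continuous_evalChar (a : A) : Continuous fun α : Character S => S.evalChar α a := by
  by_cases h : a ∈ S
  · simp only [S.evalChar_of_mem _ h]
    exact Character.continuous_eval (A := S) ⟨a, h⟩
  · simp only [evalChar, dif_neg h]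
    exact continuous_const

theorem evalChar_add (α : Character S) {a b : A} (ha : a ∈ S) (hb : b ∈ S) :
    S.evalChar α (a + b) = S.evalChar α a + S.evalChar α b := by
  rw [S.evalChar_of_mem α ha, S.evalChar_of_mem α hb, S.evalChar_of_mem α (S.add_mem ha hb),
    ← map_add]
  rfl

theorem evalChar_mul (α : Character S) {a b : A} (ha : a ∈ S) (hb : b ∈ S) :
    S.evalChar α (a * b) = S.evalChar α a * S.evalChar α b := by
  rw [S.evalChar_of_mem α ha, S.evalChar_of_mem α hb, S.evalChar_of_mem α (S.mul_mem ha hb),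
    ← map_mul]
  rfl

theorem evalChar_algebraMap (α : Character S) (r : ℝ) :
    S.evalChar α (algebraMap ℝ A r) = r := by
  rw [S.evalChar_of_mem α (S.algebraMap_mem r)]
  exact α.commutes r

theorem evalChar_smul (α : Character S) (r : ℝ) {a : A} (ha : a ∈ S) :
    S.evalChar α (r • a) = r * S.evalChar α a := by
  rw [Algebra.smul_def, S.evalChar_mul α (S.algebraMap_mem r) ha, evalChar_algebraMap]

theorem evalChar_neg (α : Character S) {a : A} (ha : a ∈ S) :
    S.evalChar α (-a) = -S.evalChar α a := by
  rw [← neg_one_smul ℝ a, S.evalChar_smul α _ ha, neg_one_mul]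

theorem evalChar_sub (α : Character S) {a b : A} (ha : a ∈ S) (hb : b ∈ S) :
    S.evalChar α (a - b) = S.evalChar α a - S.evalChar α b := by
  rw [sub_eq_add_neg, S.evalChar_add α ha (S.neg_mem hb), S.evalChar_neg α hb, sub_eq_add_neg]

theorem evalChar_sum (α : Character S) {I : Type*} (s : Finset I) {y : I → A}
    (hy : ∀ e ∈ s, y e ∈ S) :
    S.evalChar α (∑ e ∈ s, y e) = ∑ e ∈ s, S.evalChar α (y e) := by
  classical
  induction s using Finset.induction_on with
  | empty => simpa using S.evalChar_algebraMap α 0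
  | insert a s ha ih =>
    have h1 : ∀ e ∈ s, y e ∈ S := fun e he => hy e (Finset.mem_insert_of_mem he)
    rw [Finset.sum_insert ha, Finset.sum_insert ha,
      S.evalChar_add α (hy a (Finset.mem_insert_self a s)) (S.sum_mem h1), ih h1]

end Subalgebra

/-- A functional given by integration with total mass one has only integrable integrands. -/
theorem integrable_of_forall_eq_integral {X : Type*} [MeasurableSpace X] {μ : Measure X}
    {B : Type*} [Ring B] [Algebra ℝ B] (L : B →ₗ[ℝ] ℝ) (hL1 : L 1 = 1) {φ : B → X → ℝ}
    (hφ1 : ∀ ω, φ 1 ω = 1) (hφ : ∀ a b ω, φ (a + b) ω = φ a ω + φ b ω)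
    (hL : ∀ a, L a = ∫ ω, φ a ω ∂μ) : IsProbabilityMeasure μ ∧ ∀ a, Integrable (φ a) μ := by
  have hμ : IsProbabilityMeasure μ := by
    have h := hL 1
    simp only [hL1, hφ1, integral_const, smul_eq_mul, mul_one] at h
    exact ⟨by rw [← ENNReal.toReal_eq_one_iff, ← measureReal_def, ← h]⟩
  refine ⟨hμ, fun a => ?_⟩
  by_contra hcon
  have h1 : φ (a + 1) = fun ω => φ a ω + 1 := by
    ext ω
    rw [hφ, hφ1]
  have h2 : ¬Integrable (φ (a + 1)) μ := fun h => hcon (by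
    rw [h1] at h
    exact (h.sub (integrable_const (1 : ℝ))).congr (ae_of_all _ fun ω => by simp))
  have h3 := hL (a + 1)
  rw [integral_undef h2, map_add, hL a, integral_undef hcon, hL1] at h3
  norm_num at h3

theorem HilbSeminorm.toFun_sq {V : Type*} [AddCommGroup V] [Module ℝ V] (p : HilbSeminorm V)
    (v : V) : p.toFun v ^ 2 = p.bilin v v := Real.sq_sqrt (p.nonneg v)

theorem HilbSeminorm.toFun_nonneg {V : Type*} [AddCommGroup V] [Module ℝ V] (p : HilbSeminorm V)
    (v : V) : 0 ≤ p.toFun v := Real.sqrt_nonneg _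

variable {V : Submodule ℝ A} {p q : HilbSeminorm V}

theorem ae_evalChar_eq_zero {S : Subalgebra ℝ A} {μ : Measure (Character S)}
    (hconc : ∀ ε > (0 : ℝ), ∃ δ > (0 : ℝ), ∀ v : V, ∀ hv : (v : A) ∈ S,
      p.toFun v ≤ δ → μ {α : Character S | 1 ≤ |α ⟨v, hv⟩|} ≤ ENNReal.ofReal ε)
    {v : V} (hv : (v : A) ∈ S) (hpv : p.bilin v v = 0) : ∀ᵐ α ∂μ, S.evalChar α v = 0 := by
  have h1 : ∀ k : ℕ, μ {α : Character S | 1 ≤ |(k : ℝ) * S.evalChar α v|} = 0 := fun k => by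
    refine le_antisymm (ENNReal.le_of_forall_pos_le_add fun ε hε _ => ?_) bot_le
    obtain ⟨δ, hδ, h⟩ := hconc ε hε
    have hkv : (((k : ℝ) • v : V) : A) ∈ S := S.smul_mem hv _
    have h2 := h ((k : ℝ) • v) hkv (by
      rw [HilbSeminorm.toFun]
      simp only [map_smul, LinearMap.smul_apply, smul_eq_mul, hpv]
      simpa using hδ.le)
    rw [S.setOf_one_le_abs_eq hkv] at h2
    simp only [V.coe_smul, S.evalChar_smul _ _ hv] at h2
    simpa using h2
  have h2 : ∀ᵐ α ∂μ, ∀ k : ℕ, ¬1 ≤ |(k : ℝ) * S.evalChar α v| :=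
    ae_all_iff.2 fun k => by simpa [ae_iff] using h1 k
  filter_upwards [h2] with α hα
  by_contra hne
  obtain ⟨k, hk⟩ := exists_nat_ge |S.evalChar α v|⁻¹
  refine hα k ?_
  rw [abs_mul, Nat.abs_cast]
  have h3 : 0 < |S.evalChar α v| := abs_pos.2 hne
  calc (1 : ℝ) = |S.evalChar α v|⁻¹ * |S.evalChar α v| := by field_simp
    _ ≤ _ := by gcongr

/-- The basic tail estimate: concentration with respect to `p` and finite trace of `p` with respect
to `q` give uniform `q`-boundedness up to small measure. -/
theorem measureReal_not_bounded_le (hpq : p.trace q < ⊤) {S : Subalgebra ℝ A}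
    (μ : Measure (Character S)) [IsProbabilityMeasure μ] (F : Finset V)
    (hF : ∀ v ∈ Submodule.span ℝ (F : Set V), (v : A) ∈ S) {ε δ R : ℝ} (hε : 0 ≤ ε) (hδ : 0 < δ)
    (hR : 0 < R)
    (hconc : ∀ v : V, ∀ hv : (v : A) ∈ S,
      p.toFun v ≤ δ → μ {α : Character S | 1 ≤ |α ⟨v, hv⟩|} ≤ ENNReal.ofReal ε)
    (hnull : ∀ v : V, (v : A) ∈ S → p.bilin v v = 0 → ∀ᵐ α ∂μ, S.evalChar α v = 0) :
    μ.real {α | ∀ v ∈ F, |S.evalChar α v| ≤ R * q.toFun v}ᶜ ≤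
      14 / 3 * (ε + (2 / R) ^ 2 / δ ^ 2 * (p.trace q).toReal) := by
  classical
  obtain ⟨E, hE, hEF, hFE⟩ := q.exists_isONS F
  have hES : ∀ e ∈ E, (e : A) ∈ S := fun e he => hF e (hEF e he)
  set t := 2 / R with ht
  set Y : V → Character S → ℝ := fun e α => t * S.evalChar α e with hY
  set b : Finset V → ℝ := fun T =>
    ε + t ^ 2 / δ ^ 2 * p.bilin (signedSum E T id) (signedSum E T id) with hb
  have hmain : 3 / 14 * 2 ^ E.card * μ.real {α | 4 ≤ ∑ e ∈ E, Y e α ^ 2} ≤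
      ∑ T ∈ E.powerset, b T := by
    refine measureReal_four_le_sum_sq_le μ E
      (fun e => (S.continuous_evalChar e).measurable.const_mul t) fun T hT => ?_
    have hmem : ∀ e ∈ E, ((if e ∈ T then e else -e : V) : A) ∈ S := fun e he => by
      split_ifs
      exacts [hES e he, S.neg_mem (hES e he)]
    have hvS : (signedSum E T id : V).1 ∈ S := by
      simp only [signedSum, id, AddSubmonoidClass.coe_finsetSum]
      exact S.sum_mem hmem
    have htvS : ((t • signedSum E T id : V) : A) ∈ S := S.smul_mem hvS t
    have heq : ∀ α, (signedSum E T fun e => Y e α) = S.evalChar α (t • signedSum E T id : V) := by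
      intro α
      rw [V.coe_smul, S.evalChar_smul α t hvS]
      simp only [signedSum, id, AddSubmonoidClass.coe_finsetSum]
      rw [S.evalChar_sum α E hmem, Finset.mul_sum]
      refine Finset.sum_congr rfl fun e he => ?_
      split_ifs
      · rfl
      · rw [V.coe_neg, S.evalChar_neg α (hES e he), hY, mul_neg]
    have hp0 := p.nonneg (signedSum E T id)
    change μ.real {α | 1 ≤ |signedSum E T fun e => Y e α|} ≤ b T
    simp only [heq]
    by_cases hsmall : p.toFun (t • signedSum E T id) ≤ δ
    · have h1 := hconc _ htvS hsmall
      rw [S.setOf_one_le_abs_eq htvS] at h1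
      have h2 := ENNReal.toReal_mono ENNReal.ofReal_ne_top h1
      rw [ENNReal.toReal_ofReal hε] at h2
      refine h2.trans ?_
      simp only [hb]
      have : 0 ≤ t ^ 2 / δ ^ 2 * p.bilin (signedSum E T id) (signedSum E T id) := by positivity
      linarith
    · have h1 : δ ^ 2 ≤ p.toFun (t • signedSum E T id) ^ 2 :=
        pow_le_pow_left₀ hδ.le (not_le.1 hsmall).le 2
      rw [p.toFun_sq] at h1
      simp only [map_smul, LinearMap.smul_apply, smul_eq_mul] at h1
      refine measureReal_le_one.trans ?_
      simp only [hb]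
      have h2 : 1 ≤ t ^ 2 / δ ^ 2 * p.bilin (signedSum E T id) (signedSum E T id) := by
        rw [div_mul_eq_mul_div, one_le_div (by positivity)]
        linarith
      linarith
  have hsum : ∑ T ∈ E.powerset, b T ≤
      2 ^ E.card * (ε + t ^ 2 / δ ^ 2 * (p.trace q).toReal) := by
    simp only [hb]
    rw [Finset.sum_add_distrib, ← Finset.mul_sum, sum_powerset_signedSum, Finset.sum_const,
      Finset.card_powerset, nsmul_eq_mul, mul_add]
    have h1 : t ^ 2 / δ ^ 2 * ∑ e ∈ E, p.bilin (id e) (id e) ≤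
        t ^ 2 / δ ^ 2 * (p.trace q).toReal := by
      gcongr
      exact hE.sum_bilin_le_trace hpq
    have h2 := mul_le_mul_of_nonneg_left h1 (by positivity : (0 : ℝ) ≤ 2 ^ E.card)
    push_cast
    linarith
  have hle : μ.real {α | 4 ≤ ∑ e ∈ E, Y e α ^ 2} ≤
      14 / 3 * (ε + t ^ 2 / δ ^ 2 * (p.trace q).toReal) := by
    have h1 : (0 : ℝ) < 2 ^ E.card := by positivity
    have h2 := hmain.trans hsum
    have h3 : 3 / 14 * μ.real {α | 4 ≤ ∑ e ∈ E, Y e α ^ 2} ≤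
        ε + t ^ 2 / δ ^ 2 * (p.trace q).toReal := by
      refine le_of_mul_le_mul_left ?_ h1
      linarith
    linarith
  refine le_trans ?_ hle
  refine ENNReal.toReal_mono (measure_ne_top _ _) (measure_mono_ae ?_)
  choose! w hwE hw using hFE
  have hspan : Submodule.span ℝ (E : Set V) ≤ Submodule.span ℝ (F : Set V) :=
    Submodule.span_le.2 hEF
  have hvS : ∀ v ∈ F, (v : A) ∈ S := fun v hv => hF v (Submodule.subset_span hv)
  have hwS : ∀ v ∈ F, (w v : A) ∈ S := fun v hv => hF _ (hspan (hwE v hv))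
  have hae : ∀ᵐ α ∂μ, ∀ v ∈ F, S.evalChar α ((v - w v : V) : A) = 0 :=
    (Finset.eventually_all F).2 fun v hv =>
      hnull _ (S.sub_mem (hvS v hv) (hwS v hv))
        (HilbSeminorm.bilin_eq_zero_of_trace_lt_top hpq (hw v hv))
  filter_upwards [hae] with α hα hbad
  change 4 ≤ ∑ e ∈ E, Y e α ^ 2
  by_contra hlt
  refine hbad fun v hv => ?_
  have h1 : S.evalChar α v = S.evalChar α (w v) := by
    have := hα v hv
    rw [V.coe_sub, S.evalChar_sub α (hvS v hv) (hwS v hv)] at this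
    linarith
  obtain ⟨c, -, hc⟩ := Submodule.mem_span_finset.1 (hwE v hv)
  have h2 : q.bilin v v = ∑ e ∈ E, c e ^ 2 := by
    rw [q.bilin_self_eq_of_sub (hw v hv), ← hc, hE.bilin_sum]
  have h3 : S.evalChar α (w v) = ∑ e ∈ E, c e * S.evalChar α e := by
    rw [← hc, AddSubmonoidClass.coe_finsetSum]
    simp only [V.coe_smul]
    rw [S.evalChar_sum α E fun e he => S.smul_mem (hES e he) (c e)]
    exact Finset.sum_congr rfl fun e he => S.evalChar_smul α (c e) (hES e he)
  have h4 : ∑ e ∈ E, S.evalChar α e ^ 2 ≤ R ^ 2 := by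
    have h5 : t ^ 2 * ∑ e ∈ E, S.evalChar α e ^ 2 ≤ 4 := by
      rw [Finset.mul_sum]
      simpa only [hY, mul_pow] using (not_le.1 hlt).le
    rw [ht, div_pow, div_mul_eq_mul_div, div_le_iff₀ (by positivity)] at h5
    linarith
  refine abs_le_of_sq_le_sq ?_ (mul_nonneg hR.le (q.toFun_nonneg v))
  rw [h1, h3, mul_pow, q.toFun_sq, h2]
  calc (∑ e ∈ E, c e * S.evalChar α e) ^ 2
      ≤ (∑ e ∈ E, c e ^ 2) * ∑ e ∈ E, S.evalChar α e ^ 2 :=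
        Finset.sum_mul_sq_le_sq_mul_sq E _ _
    _ ≤ (∑ e ∈ E, c e ^ 2) * R ^ 2 :=
        mul_le_mul_of_nonneg_left h4 (Finset.sum_nonneg fun e _ => sq_nonneg _)
    _ = _ := mul_comm _ _

end Evaluation

section Sufficiency

variable {A : Type*} [CommRing A] [Algebra ℝ A] {V : Submodule ℝ A}

theorem exists_bound_of_mem_adjoin (c : V → ℝ) {a : A} (ha : a ∈ Algebra.adjoin ℝ (V : Set A)) :
    ∃ (F : Finset V) (M : ℝ), ∀ S : Subalgebra ℝ A, (∀ v ∈ F, (v : A) ∈ S) → a ∈ S ∧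
      ∀ α : Character S, (∀ v ∈ F, |S.evalChar α v| ≤ c v) → |S.evalChar α a| ≤ M := by
  classical
  induction ha using Algebra.adjoin_induction with
  | mem x hx =>
    exact ⟨{⟨x, hx⟩}, c ⟨x, hx⟩, fun S hS => ⟨hS ⟨x, hx⟩ (Finset.mem_singleton_self _),
      fun α hα => hα ⟨x, hx⟩ (Finset.mem_singleton_self _)⟩⟩
  | algebraMap r =>
    exact ⟨∅, |r|, fun S _ => ⟨S.algebraMap_mem r, fun α _ => by rw [S.evalChar_algebraMap]⟩⟩
  | add x y _ _ ihx ihy =>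
    obtain ⟨F₁, M₁, h₁⟩ := ihx
    obtain ⟨F₂, M₂, h₂⟩ := ihy
    refine ⟨F₁ ∪ F₂, M₁ + M₂, fun S hS => ?_⟩
    obtain ⟨hx, bx⟩ := h₁ S fun v hv => hS v (Finset.mem_union_left _ hv)
    obtain ⟨hy, hby⟩ := h₂ S fun v hv => hS v (Finset.mem_union_right _ hv)
    refine ⟨S.add_mem hx hy, fun α hα => ?_⟩
    rw [S.evalChar_add α hx hy]
    exact (abs_add_le _ _).trans (add_le_add (bx α fun v hv => hα v (Finset.mem_union_left _ hv))
      (hby α fun v hv => hα v (Finset.mem_union_right _ hv)))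
  | mul x y _ _ ihx ihy =>
    obtain ⟨F₁, M₁, h₁⟩ := ihx
    obtain ⟨F₂, M₂, h₂⟩ := ihy
    refine ⟨F₁ ∪ F₂, M₁ * M₂, fun S hS => ?_⟩
    obtain ⟨hx, bx⟩ := h₁ S fun v hv => hS v (Finset.mem_union_left _ hv)
    obtain ⟨hy, hby⟩ := h₂ S fun v hv => hS v (Finset.mem_union_right _ hv)
    refine ⟨S.mul_mem hx hy, fun α hα => ?_⟩
    rw [S.evalChar_mul α hx hy, abs_mul]
    have h3 := bx α fun v hv => hα v (Finset.mem_union_left _ hv)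
    exact mul_le_mul h3 (hby α fun v hv => hα v (Finset.mem_union_right _ hv)) (abs_nonneg _)
      ((abs_nonneg _).trans h3)

theorem isCompact_boundedCharacters (hgen : Algebra.adjoin ℝ (V : Set A) = ⊤) (c : V → ℝ) :
    IsCompact (boundedCharacters (fun v : V => (v : A)) c) := by
  refine Character.isCompact_of_bounded (isClosed_boundedCharacters _ _) fun a => ?_
  obtain ⟨F, M, h⟩ := exists_bound_of_mem_adjoin c (hgen ▸ Algebra.mem_top : a ∈ _)
  refine ⟨M, fun α hα => ?_⟩
  have heval : ∀ b, (⊤ : Subalgebra ℝ A).evalChar (α.comp (⊤ : Subalgebra ℝ A).val) b = α b :=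
    fun b => Subalgebra.evalChar_of_mem _ _ Algebra.mem_top
  simpa only [heval] using (h ⊤ fun _ _ => Algebra.mem_top).2 (α.comp (⊤ : Subalgebra ℝ A).val)
    fun v _ => by simpa only [heval] using hα v

/-- The subalgebra generated by a finite subset of `V`. -/
def finsetSubalgebra (F : Finset V) : Subalgebra ℝ A :=
  Algebra.adjoin ℝ (((Submodule.span ℝ (F : Set V)).map V.subtype : Submodule ℝ A) : Set A)

theorem finsetSubalgebra_mem (F : Finset V) : finsetSubalgebra F ∈ finGenSubalgebras V := by
  refine ⟨_, Submodule.map_subtype_le _ _, ?_, rfl⟩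
  have : FiniteDimensional ℝ (Submodule.span ℝ (F : Set V)) :=
    FiniteDimensional.span_finset ℝ F
  infer_instance

theorem mem_finsetSubalgebra_of_mem_span {F : Finset V} {v : V}
    (hv : v ∈ Submodule.span ℝ (F : Set V)) : (v : A) ∈ finsetSubalgebra F :=
  Algebra.subset_adjoin (Submodule.mem_map_of_mem (f := V.subtype) hv)

theorem mem_finsetSubalgebra {F : Finset V} {v : V} (hv : v ∈ F) :
    (v : A) ∈ finsetSubalgebra F :=
  mem_finsetSubalgebra_of_mem_span (Submodule.subset_span hv)

theorem eventually_mem_finsetSubalgebra (hgen : Algebra.adjoin ℝ (V : Set A) = ⊤) (a : A) :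
    ∀ᶠ F : Finset V in atTop, a ∈ finsetSubalgebra F := by
  obtain ⟨F, M, h⟩ := exists_bound_of_mem_adjoin (fun _ => 0) (hgen ▸ Algebra.mem_top : a ∈ _)
  filter_upwards [eventually_ge_atTop F] with F' hF'
  exact (h _ fun v hv => mem_finsetSubalgebra (hF' hv)).1

theorem exists_radon_measure_of_concentrated (hgen : Algebra.adjoin ℝ (V : Set A) = ⊤)
    {p q : HilbSeminorm V} (hpq : p.trace q < ⊤) (L : A →ₗ[ℝ] ℝ) (hL1 : L 1 = 1)
    (ν : ∀ S : Subalgebra ℝ A, Measure (Character S))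
    (hν : ∀ S ∈ finGenSubalgebras V, ∀ a : S, L (a : A) = ∫ α : Character S, α a ∂(ν S))
    (hconc : Concentrated V (finGenSubalgebras V) p.toFun ν) :
    ∃ ν : Measure (Character A), IsRadonMeasure ν ∧
      (∀ a : A, L a = ∫ α : Character A, α a ∂ν) ∧
      ν {α : Character A | ¬ QContOn V q.toFun α} = 0 := by
  classical
  have hprob : ∀ F : Finset V, IsProbabilityMeasure (ν (finsetSubalgebra F)) ∧
      ∀ a : finsetSubalgebra F, Integrable (fun α : Character (finsetSubalgebra F) => α a)
        (ν (finsetSubalgebra F)) := fun F =>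
    integrable_of_forall_eq_integral (φ := fun a (α : Character (finsetSubalgebra F)) => α a)
      (L ∘ₗ (finsetSubalgebra F).val.toLinearMap) hL1
      (fun α => map_one α) (fun a b α => map_add α a b) (hν _ (finsetSubalgebra_mem F))
  have hprob' : ∀ F : Finset V, IsProbabilityMeasure (ν (finsetSubalgebra F)) :=
    fun F => (hprob F).1
  set U : Ultrafilter (Finset V) := Ultrafilter.of atTop with hU
  have hUle : (U : Filter (Finset V)) ≤ atTop := Ultrafilter.of_le _
  have hmem : ∀ a : A, ∀ᶠ F in (U : Filter (Finset V)), a ∈ finsetSubalgebra F :=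
    fun a => hUle (eventually_mem_finsetSubalgebra hgen a)
  have hx : IsApproxCharacter (U : Filter (Finset V))
      (fun F (α : Character (finsetSubalgebra F)) a => (finsetSubalgebra F).evalChar α a) := by
    refine ⟨fun a b => ?_, fun a b => ?_, fun r => ?_⟩
    · filter_upwards [hmem a, hmem b] with F ha hb α
      exact Subalgebra.evalChar_add _ α ha hb
    · filter_upwards [hmem a, hmem b] with F ha hb α
      exact Subalgebra.evalChar_mul _ α ha hb
    · exact Eventually.of_forall fun F α => Subalgebra.evalChar_algebraMap _ α r
  obtain ⟨μ, hμ, hμreg, hμL, hμ0⟩ := exists_measure_of_isApproxCharacter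
    (f := fun v : V => (v : A)) (c := fun n v => n * q.toFun v)
    (G := fun n F => {α | ∀ v ∈ F, |(finsetSubalgebra F).evalChar α v| ≤ n * q.toFun v})
    (fun F => ν (finsetSubalgebra F)) hx
    (fun F a => (Subalgebra.continuous_evalChar _ a).measurable) L
    (fun a => by
      filter_upwards [hmem a] with F ha
      simp only [Subalgebra.evalChar_of_mem _ _ ha]
      exact ⟨(hprob F).2 _, (hν _ (finsetSubalgebra_mem F) ⟨a, ha⟩).symm⟩)
    (fun n => isCompact_boundedCharacters hgen _)
    (fun n a => by
      obtain ⟨F, M, h⟩ := exists_bound_of_mem_adjoin (fun v : V => n * q.toFun v)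
        (hgen ▸ Algebra.mem_top : a ∈ _)
      refine ⟨M, ?_⟩
      filter_upwards [hUle (eventually_ge_atTop F)] with F' hF' α hα
      exact (h _ fun v hv => mem_finsetSubalgebra (hF' hv)).2 α fun v hv => hα v (hF' hv))
    (fun n v => by
      filter_upwards [hUle (eventually_ge_atTop {v})] with F' hF' α hα
      exact hα v (hF' (Finset.mem_singleton_self v)))
    (fun n F => by
      have : {α : Character (finsetSubalgebra F) |
          ∀ v ∈ F, |(finsetSubalgebra F).evalChar α v| ≤ n * q.toFun v} =
          ⋂ v ∈ F, {α | |(finsetSubalgebra F).evalChar α v| ≤ n * q.toFun v} := by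
        ext α
        simp
      rw [this]
      exact F.measurableSet_biInter fun v _ => measurableSet_le
        (Subalgebra.continuous_evalChar _ _).abs.measurable measurable_const)
    (fun F n m hnm α hα v hv => (hα v hv).trans
      (mul_le_mul_of_nonneg_right (Nat.cast_le.2 hnm) (q.toFun_nonneg v)))
    (fun ε hε => by
      obtain ⟨δ, hδ, h⟩ := hconc (3 / 28 * ε) (by positivity)
      obtain ⟨n, hn⟩ := exists_nat_gt (112 / 3 / δ ^ 2 * (p.trace q).toReal / ε)
      have htr : 0 ≤ (p.trace q).toReal := ENNReal.toReal_nonneg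
      have hn0 : (0 : ℝ) < n := lt_of_le_of_lt (by positivity) hn
      have hn1 : (1 : ℝ) ≤ n := by exact_mod_cast hn0
      refine ⟨n, Eventually.of_forall fun F => ?_⟩
      have hF := finsetSubalgebra_mem F
      refine (measureReal_not_bounded_le hpq (ν (finsetSubalgebra F)) F
        (fun v hv => mem_finsetSubalgebra_of_mem_span hv) (ε := 3 / 28 * ε) (by positivity) hδ hn0
        (h _ hF) (fun v hv hpv => ae_evalChar_eq_zero (fun ε hε => ?_) hv hpv)).trans ?_
      · obtain ⟨δ, hδ, h⟩ := hconc ε hε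
        exact ⟨δ, hδ, h _ hF⟩
      · rw [div_lt_iff₀ hε] at hn
        have h1 : (2 / (n : ℝ)) ^ 2 / δ ^ 2 * (p.trace q).toReal =
            3 / 28 * (112 / 3 / δ ^ 2 * (p.trace q).toReal) / n ^ 2 := by
          field_simp
          ring
        have h2 : (2 / (n : ℝ)) ^ 2 / δ ^ 2 * (p.trace q).toReal ≤ 3 / 28 * ε := by
          rw [h1, div_le_iff₀ (by positivity)]
          nlinarith [mul_le_mul_of_nonneg_right hn1 (mul_nonneg hn0.le hε.le)]
        linarith)
  refine ⟨μ, ⟨inferInstance, hμreg.innerRegular⟩, fun a => (hμL a).symm, ?_⟩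
  refine measure_mono_null (t := (⋃ n : ℕ, boundedCharacters (fun v : V => (v : A))
    fun v => n * q.toFun v)ᶜ) ?_ hμ0
  intro α hα hα'
  obtain ⟨n, hn⟩ := Set.mem_iUnion.1 hα'
  refine hα ⟨n + 1, by positivity, fun v => (hn v).trans ?_⟩
  exact mul_le_mul_of_nonneg_right (by linarith) (q.toFun_nonneg v)

end Sufficiency

section Necessity

/-- A countable union carries a measurable weight that is positive exactly on it and decays
quadratically in the index. -/
theorem exists_measurable_weight {X : Type*} [MeasurableSpace X] {T : ℕ → Set X}
    (hT : ∀ n, MeasurableSet (T n)) :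
    ∃ w : X → ℝ, Measurable w ∧ (∀ x, 0 ≤ w x) ∧ (∀ x, w x ≤ 1) ∧
      ∀ x ∈ ⋃ n, T n, 0 < w x ∧ ∃ n : ℕ, x ∈ T n ∧ w x * n ^ 2 ≤ 1 := by
  classical
  have hU : MeasurableSet (⋃ n, T n) := MeasurableSet.iUnion hT
  have hex : ∀ x, ∃ n, x ∈ T n ∨ x ∉ ⋃ n, T n := fun x => by
    by_cases hx : x ∈ ⋃ n, T n
    · exact (Set.mem_iUnion.1 hx).imp fun _ => Or.inl
    · exact ⟨0, Or.inr hx⟩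
  have hfind : Measurable fun x => Nat.find (hex x) :=
    measurable_find hex fun k => (hT k).union hU.compl
  refine ⟨(⋃ n, T n).indicator fun x => 1 / (1 + (Nat.find (hex x) : ℝ) ^ 2),
    Measurable.indicator ?_ hU, fun x => Set.indicator_nonneg (fun x _ => by positivity) x,
    fun x => ?_, fun x hx => ?_⟩
  · exact (measurable_from_nat (f := fun n : ℕ => 1 / (1 + (n : ℝ) ^ 2))).comp hfind
  · refine Set.indicator_apply_le' (fun _ => ?_) fun _ => zero_le_one
    rw [div_le_one (by positivity)]
    linarith [sq_nonneg (Nat.find (hex x) : ℝ)]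
  · rw [Set.indicator_of_mem hx]
    refine ⟨by positivity, Nat.find (hex x),
      (Nat.find_spec (hex x)).resolve_right (not_not.2 hx), ?_⟩
    rw [div_mul_eq_mul_div, one_mul, div_le_one (by positivity)]
    linarith

theorem exists_measureReal_lt_le {X : Type*} [MeasurableSpace X] (μ : Measure X)
    [IsFiniteMeasure μ] {w : X → ℝ} (hw : Measurable w) (hpos : ∀ᵐ x ∂μ, 0 < w x) {ε : ℝ}
    (hε : 0 < ε) : ∃ η > 0, μ.real {x | w x < η} ≤ ε := by
  have hanti : Antitone fun k : ℕ => {x | w x < 1 / ((k : ℝ) + 1)} := by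
    intro k m hkm x hx
    change w x < 1 / ((k : ℝ) + 1)
    exact lt_of_lt_of_le (show w x < 1 / ((m : ℝ) + 1) from hx) (Nat.one_div_le_one_div hkm)
  have hlim := tendsto_measure_iInter_atTop (μ := μ)
    (fun k => (measurableSet_lt hw measurable_const).nullMeasurableSet) hanti
    ⟨0, measure_ne_top _ _⟩
  have h0 : μ (⋂ k : ℕ, {x | w x < 1 / ((k : ℝ) + 1)}) = 0 := by
    refine measure_mono_null (fun x hx => ?_) (ae_iff.1 hpos)
    intro hx'
    obtain ⟨k, hk⟩ := exists_nat_one_div_lt (show 0 < w x from hx')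
    exact lt_asymm hk (Set.mem_iInter.1 hx k)
  rw [h0] at hlim
  obtain ⟨k, hk⟩ := (hlim.eventually (gt_mem_nhds (ENNReal.ofReal_pos.2 hε))).exists
  exact ⟨_, Nat.one_div_pos_of_nat (n := k), ENNReal.toReal_le_of_le_ofReal hε.le hk.le⟩

variable {A : Type*} [CommRing A] [Algebra ℝ A] {V : Submodule ℝ A}

theorem sum_sq_le_of_mem_boundedCharacters {q : HilbSeminorm V} {n : ℕ} {α : Character A}
    (hα : α ∈ boundedCharacters (fun v : V => (v : A)) fun v => n * q.toFun v)
    {E : Finset V} (hE : q.IsONS E) : ∑ e ∈ E, α (e : A) ^ 2 ≤ n ^ 2 := by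
  set s := ∑ e ∈ E, α (e : A) ^ 2 with hs
  have hs0 : 0 ≤ s := Finset.sum_nonneg fun e _ => sq_nonneg _
  set v : V := ∑ e ∈ E, α (e : A) • e with hv
  have h1 : α (v : A) = s := by
    rw [hv, AddSubmonoidClass.coe_finsetSum, map_sum, hs]
    refine Finset.sum_congr rfl fun e _ => ?_
    rw [V.coe_smul, map_smul, smul_eq_mul, sq]
  have h2 : q.toFun v ^ 2 = s := by
    rw [q.toFun_sq, hv, hE.bilin_sum (fun e => α (e : A))]
  have h3 : |α (v : A)| ≤ n * q.toFun v := hα v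
  rw [h1, abs_of_nonneg hs0] at h3
  have h4 : s ^ 2 ≤ n ^ 2 * s := by
    rw [← h2, ← mul_pow, h2]
    exact pow_le_pow_left₀ hs0 h3 2
  by_contra hcon
  nlinarith [sq_nonneg (n : ℝ)]

theorem continuous_restrict (S : Subalgebra ℝ A) :
    Continuous fun α : Character A => (α.comp S.val : Character S) :=
  continuous_induced_rng.2 (continuous_pi fun a => Character.continuous_eval (a : A))

theorem exists_concentrated_of_radon_measure {q : HilbSeminorm V} (L : A →ₗ[ℝ] ℝ)
    (hL1 : L 1 = 1) (ν : Measure (Character A)) (hR : IsRadonMeasure ν)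
    (hν : ∀ a : A, L a = ∫ α : Character A, α a ∂ν)
    (hsupp : ν {α : Character A | ¬ QContOn V q.toFun α} = 0) :
    ∃ p : HilbSeminorm V, p.trace q < ⊤ ∧
      ∃ ν : ∀ S : Subalgebra ℝ A, Measure (Character S),
        (∀ S ∈ finGenSubalgebras V, IsRadonMeasure (ν S) ∧
          ∀ a : S, L (a : A) = ∫ α : Character S, α a ∂(ν S)) ∧
        Concentrated V (finGenSubalgebras V) p.toFun ν := by
  classical
  obtain ⟨hprob, hint⟩ := integrable_of_forall_eq_integral (φ := fun a (α : Character A) => α a)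
    L hL1 (fun α => map_one α) (fun a b α => map_add α a b) hν
  have hmeas : ∀ a : A, Measurable fun α : Character A => α a :=
    fun a => (Character.continuous_eval a).measurable
  obtain ⟨w, hwm, hw0, hw1, hw⟩ := exists_measurable_weight
    (T := fun n : ℕ => boundedCharacters (fun v : V => (v : A)) fun v => n * q.toFun v)
    fun n => (isClosed_boundedCharacters _ _).measurableSet
  have hae : ∀ᵐ α ∂ν, 0 < w α ∧ ∃ n : ℕ, α ∈ boundedCharacters (fun v : V => (v : A))
      (fun v => n * q.toFun v) ∧ w α * n ^ 2 ≤ 1 := by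
    have h : ∀ᵐ α ∂ν, QContOn V q.toFun α := hsupp
    filter_upwards [h] with α hα
    obtain ⟨C, -, hC⟩ := hα
    obtain ⟨n, hn⟩ := exists_nat_ge C
    exact hw α (Set.mem_iUnion.2 ⟨n, fun v => (hC v).trans
      (mul_le_mul_of_nonneg_right hn (q.toFun_nonneg v))⟩)
  have hwint : ∀ a : A, Integrable (fun α : Character A => w α * α a) ν := fun a =>
    (hint a).bdd_mul hwm.aestronglyMeasurable (c := 1) (ae_of_all _ fun α => by
      rw [Real.norm_eq_abs, abs_of_nonneg (hw0 α)]
      exact hw1 α)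
  let K : A →ₗ[ℝ] ℝ :=
    { toFun := fun a => ∫ α : Character A, w α * α a ∂ν
      map_add' := fun a b => by
        simp only [map_add, mul_add]
        exact integral_add (hwint a) (hwint b)
      map_smul' := fun r a => by
        simp only [map_smul, smul_eq_mul, RingHom.id_apply, mul_left_comm _ r]
        exact integral_const_mul _ _ }
  have hK : ∀ a, K (a * a) = ∫ α : Character A, w α * α a ^ 2 ∂ν := fun a => by
    simp only [sq, ← map_mul]
    rfl
  have hwint2 : ∀ a : A, Integrable (fun α : Character A => w α * α a ^ 2) ν := fun a => by
    simpa only [sq, ← map_mul] using hwint (a * a)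
  have hK0 : ∀ a, 0 ≤ K (a * a) := fun a => by
    rw [hK]
    exact integral_nonneg fun α => mul_nonneg (hw0 α) (sq_nonneg _)
  set p : HilbSeminorm V := (sLSeminorm K hK0).comp V.subtype with hp
  have hpv : ∀ v : V, p.bilin v v = ∫ α : Character A, w α * α (v : A) ^ 2 ∂ν :=
    fun v => hK v
  have htrace : p.trace q ≤ 1 := by
    rw [HilbSeminorm.trace, if_pos]
    · refine iSup₂_le fun E hE => ?_
      rw [ENNReal.ofReal_le_one]
      simp only [hpv]
      rw [← integral_finsetSum _ fun (e : V) _ => hwint2 e]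
      refine (integral_mono_ae (integrable_finsetSum _ fun (e : V) _ => hwint2 e)
        (integrable_const (1 : ℝ)) ?_).trans (by simp)
      filter_upwards [hae] with α hα
      obtain ⟨-, n, hn, hn1⟩ := hα
      rw [← Finset.mul_sum]
      exact (mul_le_mul_of_nonneg_left (sum_sq_le_of_mem_boundedCharacters hn hE) (hw0 α)).trans
        hn1
    · intro v hv
      rw [hpv]
      refine integral_eq_zero_of_ae ?_
      filter_upwards [hae] with α hα
      obtain ⟨-, n, hn, -⟩ := hα
      have h1 : |α (v : A)| ≤ n * q.toFun v := hn v
      rw [HilbSeminorm.toFun, hv, Real.sqrt_zero, mul_zero] at h1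
      simp [abs_nonpos_iff.1 h1]
  refine ⟨p, htrace.trans_lt ENNReal.one_lt_top, fun S => ν.map fun α => α.comp S.val,
    fun S _ => ⟨⟨?_, ?_⟩, fun a => ?_⟩, fun ε hε => ?_⟩
  · have : IsFiniteMeasure (ν.map fun α : Character A => (α.comp S.val : Character S)) :=
      Measure.isFiniteMeasure_map ν _
    exact IsFiniteMeasure.toIsLocallyFiniteMeasure _
  · have : ν.InnerRegular := ⟨hR.2⟩
    exact (Measure.InnerRegular.map_of_continuous (continuous_restrict S)).innerRegular
  · rw [integral_map (continuous_restrict S).measurable.aemeasurable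
      (Character.continuous_eval (A := S) a).measurable.aestronglyMeasurable]
    exact hν a
  · obtain ⟨η, hη, hwη⟩ := exists_measureReal_lt_le ν hwm (hae.mono fun _ h => h.1) (half_pos hε)
    refine ⟨√(η * (ε / 2)), Real.sqrt_pos.2 (by positivity), fun S _ v hv hpδ => ?_⟩
    have hpδ' : p.bilin v v ≤ η * (ε / 2) := by
      rw [← p.toFun_sq, ← Real.sq_sqrt (show 0 ≤ η * (ε / 2) by positivity)]
      exact pow_le_pow_left₀ (p.toFun_nonneg v) hpδ 2
    rw [Measure.map_apply (continuous_restrict S).measurable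
      (measurableSet_le measurable_const
        (Character.continuous_eval (A := S) ⟨v, hv⟩).abs.measurable)]
    have hsub : (fun α : Character A => (α.comp S.val : Character S)) ⁻¹'
        {α : Character S | 1 ≤ |α ⟨v, hv⟩|} ⊆
        {α | w α < η} ∪ {α | η ≤ w α * α (v : A) ^ 2} := fun α hα => by
      have h1 : 1 ≤ |α (v : A)| := hα
      rcases lt_or_ge (w α) η with h | h
      · exact Or.inl h
      · refine Or.inr (h.trans (le_mul_of_one_le_right (hw0 α) ?_))
        rw [← sq_abs]
        exact one_le_pow₀ h1
    have hmarkov : η * ν.real {α : Character A | η ≤ w α * α (v : A) ^ 2} ≤ η * (ε / 2) :=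
      (mul_meas_ge_le_integral_of_nonneg
        (ae_of_all _ fun α => mul_nonneg (hw0 α) (sq_nonneg _)) (hwint2 v) η).trans
        (by rw [← hpv]; exact hpδ')
    rw [← ENNReal.ofReal_toReal (measure_ne_top ν _)]
    refine ENNReal.ofReal_le_ofReal ((measureReal_mono hsub).trans
      ((measureReal_union_le _ _).trans ?_))
    linarith [le_of_mul_le_mul_left hmarkov hη]

end Necessity

end Helpers

/-- Theorem `MainThm`: criterion for the existence of a representing
Radon measure supported on the `q`-continuous characters. -/
theorem statement0 {A : Type*} [CommRing A] [Algebra ℝ A]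
    (V : Submodule ℝ A) (hgen : Algebra.adjoin ℝ (V : Set A) = ⊤)
    (q : HilbSeminorm ↥V)
    (hT : ∃ α : Character A, QContOn V q.toFun α)
    (L : A →ₗ[ℝ] ℝ) (hL1 : L 1 = 1) :
    (∃ ν : Measure (Character A), IsRadonMeasure ν ∧
        (∀ a : A, L a = ∫ α : Character A, α a ∂ν) ∧
        ν {α : Character A | ¬ QContOn V q.toFun α} = 0) ↔
    (∃ p : HilbSeminorm ↥V, p.trace q < ⊤ ∧
      ∃ ν : ∀ S : Subalgebra ℝ A, Measure (Character ↥S),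
        (∀ S ∈ finGenSubalgebras V, IsRadonMeasure (ν S) ∧
          ∀ a : S, L (a : A) = ∫ α : Character ↥S, α a ∂(ν S)) ∧
        Concentrated V (finGenSubalgebras V) p.toFun ν) := by
  constructor
  · rintro ⟨ν, hR, hν, hsupp⟩
    exact exists_concentrated_of_radon_measure L hL1 ν hR hν hsupp
  · rintro ⟨p, hpq, ν, hν, hconc⟩
    exact exists_radon_measure_of_concentrated hgen hpq L hL1 ν (fun S hS => (hν S hS).2) hconc
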